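/- arXiv:2004.07673 — 3 statements merged into one kernel-verified Lean document; each statement's English description precedes it below -/
import Mathlib

section
/- Let α₁₁, α₁₂, α₂₁, α₂₂ be strictly positive real numbers with α₁₁ + α₁₂ + α₂₁ + α₂₂ = 1. Then the maximum over sign choices a₁, a₂, b₁, b₂ ∈ {−1, 1} of the quantity α₁₁·a₁b₁ + α₁₂·a₁b₂ + α₂₁·a₂b₁ − α₂₂·a₂b₂ equals 1 − 2·min{α₁₁, α₁₂, α₂₁, α₂₂}. In other words, the classical (local deterministic) value of the tilted CHSH correlation expression α₁₁⟨A₁B₁⟩ + α₁₂⟨A₁B₂⟩ + α₂₁⟨A₂B₁⟩ − α₂₂⟨A₂B₂⟩ is 1 − 2·min{α₁₁, α₁₂, α₂₁, α₂₂}. -/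
/-- The classical (local deterministic) value of the tilted CHSH
correlation expression `α₁₁⟨A₁B₁⟩ + α₁₂⟨A₁B₂⟩ + α₂₁⟨A₂B₁⟩ − α₂₂⟨A₂B₂⟩`, with strictly
positive coefficients summing to `1`, equals `1 − 2·min{α₁₁, α₁₂, α₂₁, α₂₂}`. -/
theorem tilted_chsh_classical_value
    (α₁₁ α₁₂ α₂₁ α₂₂ : ℝ)
    (h11 : 0 < α₁₁) (h12 : 0 < α₁₂) (h21 : 0 < α₂₁) (h22 : 0 < α₂₂)
    (hsum : α₁₁ + α₁₂ + α₂₁ + α₂₂ = 1) :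
    IsGreatest
      {v : ℝ | ∃ a₁ a₂ b₁ b₂ : ℝ,
        (a₁ = 1 ∨ a₁ = -1) ∧ (a₂ = 1 ∨ a₂ = -1) ∧
        (b₁ = 1 ∨ b₁ = -1) ∧ (b₂ = 1 ∨ b₂ = -1) ∧
        v = α₁₁ * (a₁ * b₁) + α₁₂ * (a₁ * b₂) + α₂₁ * (a₂ * b₁) - α₂₂ * (a₂ * b₂)}
      (1 - 2 * min (min α₁₁ α₁₂) (min α₂₁ α₂₂)) := by
  constructor
  · rcases min_choice (min α₁₁ α₁₂) (min α₂₁ α₂₂) with h | h <;> rw [h]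
    · rcases min_choice α₁₁ α₁₂ with h | h <;> rw [h]
      · exact ⟨1, -1, -1, 1, by simp, by simp, by simp, by simp, by linarith⟩
      · exact ⟨1, 1, 1, -1, by simp, by simp, by simp, by simp, by linarith⟩
    · rcases min_choice α₂₁ α₂₂ with h | h <;> rw [h]
      · exact ⟨1, -1, 1, 1, by simp, by simp, by simp, by simp, by linarith⟩
      · exact ⟨1, 1, 1, 1, by simp, by simp, by simp, by simp, by linarith⟩
  · rintro v ⟨a₁, a₂, b₁, b₂, ha₁, ha₂, hb₁, hb₂, rfl⟩
    have hl := min_le_left (min α₁₁ α₁₂) (min α₂₁ α₂₂)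
    have hr := min_le_right (min α₁₁ α₁₂) (min α₂₁ α₂₂)
    have m₁₁ := hl.trans (min_le_left α₁₁ α₁₂)
    have m₁₂ := hl.trans (min_le_right α₁₁ α₁₂)
    have m₂₁ := hr.trans (min_le_left α₂₁ α₂₂)
    have m₂₂ := hr.trans (min_le_right α₂₁ α₂₂)
    rcases ha₁ with rfl | rfl <;> rcases ha₂ with rfl | rfl <;>
      rcases hb₁ with rfl | rfl <;> rcases hb₂ with rfl | rfl <;> linarith
end

section
/- Fix 0 ≤ α ≤ 1 and consider the (2-input, 2-output per party) Bell expression I_α(P) = P(0,0|0,0) + α·P(1,1|0,0) − P(0,1|0,1) − P(1,0|1,0) − P(0,0|1,1). Then for every local deterministic box P_{f,g} given by functions f, g : {0,1} → {0,1} via P_{f,g}(a,b|x,y) = [f(x)=a]·[g(y)=b], one has I_α(P_{f,g}) ≤ α, and there exists a local deterministic box attaining I_α = α (e.g., f ≡ 1, g ≡ 1). Hence the classical value of I_α is α. -/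
namespace TiltedBell

/-- A box in the 2-input/2-output Bell scenario: `P (a, b, x, y)` is `P(a,b|x,y)`. -/
abbrev Box := Fin 2 × Fin 2 × Fin 2 × Fin 2 → ℝ

/-- The Bell expression
`I_α(P) = P(0,0|0,0) + α·P(1,1|0,0) − P(0,1|0,1) − P(1,0|1,0) − P(0,0|1,1)`. -/
def Iexpr (α : ℝ) (P : Box) : ℝ :=
  P (0, 0, 0, 0) + α * P (1, 1, 0, 0) - P (0, 1, 0, 1) - P (1, 0, 1, 0) - P (0, 0, 1, 1)

/-- The local deterministic box `P_{f,g}(a,b|x,y) = [f(x)=a]·[g(y)=b]`. -/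
def detBox (f g : Fin 2 → Fin 2) : Box :=
  fun e => (if f e.2.2.1 = e.1 then 1 else 0) * (if g e.2.2.2 = e.2.1 then 1 else 0)

/-- For `0 ≤ α ≤ 1`, every local deterministic box satisfies
`I_α ≤ α`, and the local deterministic box with `f ≡ 1`, `g ≡ 1` attains `I_α = α`;
hence the classical value of `I_α` is `α`. -/
theorem classical_value_of_Iexpr (α : ℝ) (hα0 : 0 ≤ α) (hα1 : α ≤ 1) :
    (∀ f g : Fin 2 → Fin 2, Iexpr α (detBox f g) ≤ α) ∧
      Iexpr α (detBox (fun _ => 1) (fun _ => 1)) = α := by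
  refine ⟨fun f g => ?_, by simp [Iexpr, detBox]⟩
  simp only [Iexpr, detBox]
  generalize f 0 = a₀, f 1 = a₁, g 0 = b₀, g 1 = b₁
  fin_cases a₀ <;> fin_cases a₁ <;> fin_cases b₀ <;> fin_cases b₁ <;> simp <;> linarith

end TiltedBell
end

section
/- Fix 0 ≤ α ≤ 1 and consider the Bell expression I_α(P) = P(0,0|0,0) + α·P(1,1|0,0) − P(0,1|0,1) − P(1,0|1,0) − P(0,0|1,1) in the Bell scenario with two inputs and two outputs per party. Then: (i) for every normalized no-signalling box P one has I_α(P) ≤ (1+α)/2; and (ii) the Popescu–Rohrlich box P_PR defined by P_PR(a,b|x,y) = 1/2 if a ⊕ b = x·y and P_PR(a,b|x,y) = 0 otherwise, is a normalized no-signalling box achieving I_α(P_PR) = (1+α)/2. Hence the maximal no-signalling value of I_α is (1+α)/2. -/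
namespace TiltedBell

/-- A normalized no-signalling box in the 2-input/2-output Bell scenario. -/
def IsNSBox (P : Box) : Prop :=
  (∀ e, 0 ≤ P e) ∧
  (∀ x y : Fin 2, ∑ a : Fin 2, ∑ b : Fin 2, P (a, b, x, y) = 1) ∧
  (∀ x x' y b : Fin 2, ∑ a : Fin 2, P (a, b, x, y) = ∑ a : Fin 2, P (a, b, x', y)) ∧
  (∀ x y y' a : Fin 2, ∑ b : Fin 2, P (a, b, x, y) = ∑ b : Fin 2, P (a, b, x, y'))

/-- The Popescu–Rohrlich box: `P(a,b|x,y) = 1/2` if `a ⊕ b = x·y`, else `0`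
(arithmetic in `Fin 2` is mod `2`). -/
noncomputable def PRbox : Box :=
  fun e => if e.1 + e.2.1 = e.2.2.1 * e.2.2.2 then 1 / 2 else 0

/-- The Clauser–Horne-type expression `I_0` is at most `1/2` on no-signalling boxes. -/
theorem IsNSBox.Iexpr_zero_le {P : Box} (hP : IsNSBox P) : Iexpr 0 P ≤ 1 / 2 := by
  obtain ⟨hpos, hnorm, hA, hB⟩ := hP
  simp only [Fin.sum_univ_two] at hnorm hA hB
  have hp (a b x y : Fin 2) := hpos (a, b, x, y)
  simp only [Iexpr]
  linarith [hp 0 0 0 0, hp 0 1 0 0, hp 1 0 0 0, hp 1 1 0 0,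
    hp 0 0 0 1, hp 0 1 0 1, hp 1 0 0 1, hp 1 1 0 1,
    hp 0 0 1 0, hp 0 1 1 0, hp 1 0 1 0, hp 1 1 1 0,
    hp 0 0 1 1, hp 0 1 1 1, hp 1 0 1 1, hp 1 1 1 1,
    hnorm 0 0, hnorm 0 1, hnorm 1 0, hnorm 1 1,
    hA 0 1 0 0, hA 0 1 0 1, hA 0 1 1 0, hA 0 1 1 1,
    hB 0 0 1 0, hB 0 0 1 1, hB 1 0 1 0, hB 1 0 1 1]

/-- The expression `I_1` is at most `1` on no-signalling boxes. -/
theorem IsNSBox.Iexpr_one_le {P : Box} (hP : IsNSBox P) : Iexpr 1 P ≤ 1 := by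
  obtain ⟨hpos, hnorm, -, -⟩ := hP
  have h := hnorm 0 0
  simp only [Fin.sum_univ_two] at h
  simp only [Iexpr]
  linarith [hpos (0, 1, 0, 0), hpos (1, 0, 0, 0), hpos (0, 1, 0, 1), hpos (1, 0, 1, 0),
    hpos (0, 0, 1, 1)]

/-- The expression `I_α` is affine in `α`. -/
theorem Iexpr_eq_affine (α : ℝ) (P : Box) :
    Iexpr α P = (1 - α) * Iexpr 0 P + α * Iexpr 1 P := by
  simp only [Iexpr]
  ring

theorem fin_two_one_add_one : (1 : Fin 2) + 1 = 0 := rfl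

/-- The Popescu–Rohrlich box is a normalized no-signalling box. -/
theorem isNSBox_PRbox : IsNSBox PRbox := by
  refine ⟨fun e => ?_, fun x y => ?_, fun x x' y b => ?_, fun x y y' a => ?_⟩
  · simp only [PRbox]
    split_ifs <;> norm_num
  · fin_cases x <;> fin_cases y <;> norm_num [PRbox, Fin.sum_univ_two, fin_two_one_add_one]
  · fin_cases x <;> fin_cases x' <;> fin_cases y <;> fin_cases b <;>
      norm_num [PRbox, Fin.sum_univ_two, fin_two_one_add_one]
  · fin_cases x <;> fin_cases y <;> fin_cases y' <;> fin_cases a <;>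
      norm_num [PRbox, Fin.sum_univ_two, fin_two_one_add_one]

/-- For `0 ≤ α ≤ 1`: (i) every normalized no-signalling box `P`
satisfies `I_α(P) ≤ (1+α)/2`; (ii) the Popescu–Rohrlich box is a normalized
no-signalling box achieving `I_α = (1+α)/2`. Hence the maximal no-signalling value of
`I_α` is `(1+α)/2`. -/
theorem no_signalling_value_of_Iexpr (α : ℝ) (hα0 : 0 ≤ α) (hα1 : α ≤ 1) :
    (∀ P : Box, IsNSBox P → Iexpr α P ≤ (1 + α) / 2) ∧
      IsNSBox PRbox ∧ Iexpr α PRbox = (1 + α) / 2 := by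
  refine ⟨fun P hP => ?_, isNSBox_PRbox, ?_⟩
  · rw [Iexpr_eq_affine]
    linarith [mul_le_mul_of_nonneg_left hP.Iexpr_zero_le (sub_nonneg.2 hα1),
      mul_le_mul_of_nonneg_left hP.Iexpr_one_le hα0]
  · norm_num [Iexpr, PRbox, fin_two_one_add_one]
    ring

end TiltedBell
end
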